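/- Let Ω ⊂ ℂⁿ be a smoothly bounded strongly convex domain and φ a holomorphic self-map of Ω whose components extend holomorphically to a neighborhood of closure(Ω). If C_φ is compact on A²(Ω), then ∂Ω ∩ ∂(φ(closure Ω)) is nowhere dense in ∂Ω. -/

import Mathlib

open MeasureTheory Metric Filter Set Topology

noncomputable section

/-- `ℂⁿ` with its Euclidean metric. -/
abbrev Cn (n : ℕ) := EuclideanSpace ℂ (Fin n)

instance (n : ℕ) : MeasurableSpace (Cn n) := borel _
instance (n : ℕ) : BorelSpace (Cn n) := ⟨rfl⟩

/-- Membership in the Bergman space `A²(Ω)`. -/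
def InA2 {n : ℕ} (Ω : Set (Cn n)) (f : Cn n → ℂ) : Prop :=
  DifferentiableOn ℂ f Ω ∧ IntegrableOn (fun z => ‖f z‖ ^ 2) Ω volume

/-- The `A²` inner product `⟨f, g⟩ = ∫_Ω f ḡ dV`. -/
def a2Inner {n : ℕ} (Ω : Set (Cn n)) (f g : Cn n → ℂ) : ℂ :=
  ∫ z in Ω, (starRingEnd ℂ) (g z) * f z

/-- The squared `A²(Ω)` norm. -/
def a2NormSq {n : ℕ} (Ω : Set (Cn n)) (f : Cn n → ℂ) : ℝ :=
  ∫ z in Ω, ‖f z‖ ^ 2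

/-- A sequence in `A²(Ω)` converging weakly to `0`. -/
def WeakNull {n : ℕ} (Ω : Set (Cn n)) (g : ℕ → Cn n → ℂ) : Prop :=
  (∀ j, InA2 Ω (g j)) ∧
  ∀ f, InA2 Ω f → Tendsto (fun j => a2Inner Ω (g j) f) atTop (nhds 0)

/-- Compactness of the composition operator `C_φ` on `A²(Ω)`:
`C_φ` maps weakly null sequences to norm-null sequences. -/
def CompactCompOp {n : ℕ} (Ω : Set (Cn n)) (φ : Cn n → Cn n) : Prop :=
  ∀ g : ℕ → Cn n → ℂ, WeakNull Ω g →
    Tendsto (fun j => a2NormSq Ω (fun z => g j (φ z))) atTop (nhds 0)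

/-- The open unit disc in `ℂ`. -/
def uDisc : Set ℂ := Metric.ball 0 1

/-- `Δ` is a non-trivial analytic disc contained in `S`. -/
def IsNontrivialDiscIn {n : ℕ} (S : Set (Cn n)) (Δ : Set (Cn n)) : Prop :=
  ∃ F : ℂ → Cn n, DifferentiableOn ℂ F uDisc ∧ (¬ ∃ c, Set.EqOn F (fun _ => c) uDisc) ∧
    F '' uDisc = Δ ∧ Δ ⊆ S

/-- `𝓛`: the union of all non-trivial analytic discs in `∂Ω`. -/
def discUnion {n : ℕ} (Ω : Set (Cn n)) : Set (Cn n) :=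
  {p | ∃ Δ, IsNontrivialDiscIn (frontier Ω) Δ ∧ p ∈ Δ}

/-- The limit point disc condition. -/
def LimitPointDiscCond {n : ℕ} (Ω : Set (Cn n)) : Prop :=
  ∀ p ∈ closure (discUnion Ω), ∃ Δ, IsNontrivialDiscIn (frontier Ω) Δ ∧ p ∈ closure Δ

/-- A `C^k` defining function for `Ω`. -/
def IsDefiningFn {n : ℕ} (Ω : Set (Cn n)) (k : ℕ∞) (ρ : Cn n → ℝ) : Prop :=
  ContDiff ℝ k ρ ∧ Ω = {z | ρ z < 0} ∧ frontier Ω = {z | ρ z = 0} ∧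
    ∀ p ∈ frontier Ω, fderiv ℝ ρ p ≠ 0

/-- Wirtinger derivative `∂f/∂z_j` at `p`. -/
def wD {n : ℕ} (f : Cn n → ℂ) (p : Cn n) (j : Fin n) : ℂ :=
  (fderiv ℝ f p (EuclideanSpace.single j 1)
    - Complex.I * fderiv ℝ f p (EuclideanSpace.single j Complex.I)) / 2

/-- Wirtinger derivative `∂f/∂z̄_j` at `p`. -/
def wDbar {n : ℕ} (f : Cn n → ℂ) (p : Cn n) (j : Fin n) : ℂ :=
  (fderiv ℝ f p (EuclideanSpace.single j 1)
    + Complex.I * fderiv ℝ f p (EuclideanSpace.single j Complex.I)) / 2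

/-- The Levi form `∑_{j,k} ∂²ρ/∂z_j∂z̄_k (p) v_j w̄_k`. -/
def leviForm {n : ℕ} (ρ : Cn n → ℝ) (p : Cn n) (v w : Cn n) : ℂ :=
  ∑ j, ∑ k, wD (fun q => wDbar (fun z => ((ρ z : ℝ) : ℂ)) q k) p j * v j * (starRingEnd ℂ) (w k)

/-- `p` is a Levi-flat boundary point: the Levi form restricted to the complex tangent
space at `p` has a zero eigenvalue. -/
def LeviFlatPt {n : ℕ} (ρ : Cn n → ℝ) (p : Cn n) : Prop :=
  ∃ v : Cn n, v ≠ 0 ∧ (∑ j, wD (fun z => ((ρ z : ℝ) : ℂ)) p j * v j = 0) ∧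
    leviForm ρ p v v = 0

/-- Plurisubharmonicity on `Ω` (sub-mean value property on complex discs). -/
def PlurisubharmonicOn {n : ℕ} (u : Cn n → ℝ) (Ω : Set (Cn n)) : Prop :=
  UpperSemicontinuousOn u Ω ∧ ∀ a b : Cn n, ∀ r : ℝ, 0 < r →
    (∀ t : ℂ, ‖t‖ ≤ r → a + t • b ∈ Ω) →
    u a ≤ (1 / (2 * Real.pi)) *
      ∫ θ in (0:ℝ)..(2 * Real.pi), u (a + ((r * Complex.exp (θ * Complex.I)) • b))

/-- Hartogs pseudoconvexity: `-log d(·, Ωᶜ)` is plurisubharmonic on `Ω`. -/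
def IsPseudoconvex {n : ℕ} (Ω : Set (Cn n)) : Prop :=
  IsOpen Ω ∧ PlurisubharmonicOn (fun z => -Real.log (Metric.infDist z Ωᶜ)) Ω

/-- The complex Jacobian determinant of `φ` at `p`. -/
def Jdet {n : ℕ} (φ : Cn n → Cn n) (p : Cn n) : ℂ :=
  LinearMap.det (fderiv ℂ φ p).toLinearMap

/-- The unit polydisc in `ℂⁿ`. -/
def polydisc (n : ℕ) : Set (Cn n) := {z | ∀ i, ‖z i‖ < 1}

section RealTaylor

variable {E : Type*} [NormedAddCommGroup E] [NormedSpace ℝ E]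

/-- Second order Taylor expansion, with remainder `η ‖w‖²`. -/
theorem exists_taylor_two_bound {ρ : E → ℝ} (hρ : ContDiff ℝ 2 ρ) (p : E) {η : ℝ} (hη : 0 < η) :
    ∃ r > 0, ∀ w : E, ‖w‖ < r →
      |ρ (p + w) - ρ p - fderiv ℝ ρ p w - fderiv ℝ (fderiv ℝ ρ) p w w / 2| ≤ η * ‖w‖ ^ 2 := by
  have hd : Differentiable ℝ ρ := hρ.differentiable (by norm_num)
  have hd2 : Differentiable ℝ (fderiv ℝ ρ) :=
    (hρ.fderiv_right (m := 1) (by norm_num)).differentiable (by norm_num)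
  have ho := (hasFDerivAt_iff_isLittleO_nhds_zero.1 (hd2 p).hasFDerivAt).def hη
  obtain ⟨r, hr, hb⟩ := Metric.eventually_nhds_iff_ball.1 ho
  refine ⟨r, hr, fun w hw => ?_⟩
  set H := fderiv ℝ (fderiv ℝ ρ) p with hH
  have hderiv : ∀ t : ℝ, HasDerivAt
      (fun t : ℝ => ρ (p + t • w) - ρ p - t * fderiv ℝ ρ p w - t ^ 2 * (H w w / 2))
      (fderiv ℝ ρ (p + t • w) w - fderiv ℝ ρ p w - t * H w w) t := by
    intro t
    have h1 : HasDerivAt (fun t : ℝ => p + t • w) w t := by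
      simpa using ((hasDerivAt_id t).smul_const w).const_add p
    have h2 := (hd (p + t • w)).hasFDerivAt.comp_hasDerivAt t h1
    have h3 := ((h2.sub_const (ρ p)).sub ((hasDerivAt_id t).mul_const (fderiv ℝ ρ p w))).sub
      (((hasDerivAt_id t).pow 2).mul_const (H w w / 2))
    refine h3.congr_deriv ?_
    simp; ring
  have hbound : ∀ t ∈ Ico (0 : ℝ) 1,
      ‖fderiv ℝ ρ (p + t • w) w - fderiv ℝ ρ p w - t * H w w‖ ≤ η * ‖w‖ ^ 2 := by
    intro t ht
    have hn : ‖t • w‖ ≤ ‖w‖ := by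
      rw [norm_smul, Real.norm_of_nonneg ht.1]
      exact mul_le_of_le_one_left (norm_nonneg _) ht.2.le
    have := hb (t • w) (by simpa using hn.trans_lt hw)
    have h4 : fderiv ℝ ρ (p + t • w) w - fderiv ℝ ρ p w - t * H w w
        = (fderiv ℝ ρ (p + t • w) - fderiv ℝ ρ p - H (t • w)) w := by simp
    rw [h4]
    calc _ ≤ ‖fderiv ℝ ρ (p + t • w) - fderiv ℝ ρ p - H (t • w)‖ * ‖w‖ :=
          ContinuousLinearMap.le_opNorm _ _
      _ ≤ (η * ‖w‖) * ‖w‖ := by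
          gcongr
          exact this.trans (by gcongr)
      _ = _ := by ring
  have := norm_image_sub_le_of_norm_deriv_le_segment_01'
    (fun t _ => (hderiv t).hasDerivWithinAt) hbound
  simpa [sub_sub, Real.norm_eq_abs] using this

/-- A quadratic form positive on the kernel of `ℓ` becomes positive after adding `M ℓ²`. -/
theorem exists_quadratic_add_sq_ge [FiniteDimensional ℝ E] (H : E →L[ℝ] E →L[ℝ] ℝ) (ℓ : E →L[ℝ] ℝ)
    (hH : ∀ v, v ≠ 0 → ℓ v = 0 → 0 < H v v) :
    ∃ c > 0, ∃ M > 0, ∀ v, c * ‖v‖ ^ 2 ≤ H v v + M * ℓ v ^ 2 := by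
  have hHc : Continuous fun v => H v v := by fun_prop
  have hK : IsCompact (sphere (0 : E) 1) := isCompact_sphere 0 1
  have hM : ∃ M > 0, ∀ v ∈ sphere (0 : E) 1, 0 < H v v + M * ℓ v ^ 2 := by
    have hK' : IsCompact (sphere (0 : E) 1 ∩ {v | H v v ≤ 0}) :=
      hK.inter_right (isClosed_le hHc continuous_const)
    obtain ⟨B, hB⟩ := (hK.image hHc).isBounded.exists_norm_le
    rcases (sphere (0 : E) 1 ∩ {v | H v v ≤ 0}).eq_empty_or_nonempty with he | hne
    · refine ⟨1, one_pos, fun v hv => ?_⟩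
      have : 0 < H v v := by
        by_contra h
        exact Set.notMem_empty v (he ▸ ⟨hv, not_lt.1 h⟩)
      positivity
    · obtain ⟨x, hx, hmin⟩ := hK'.exists_isMinOn hne
        (f := fun v => ℓ v ^ 2) (by fun_prop)
      have hm : 0 < ℓ x ^ 2 := by
        have hx0 : x ≠ 0 := by
          rintro rfl
          simpa using hx.1
        have : ℓ x ≠ 0 := fun h => (hH x hx0 h).not_ge hx.2
        positivity
      refine ⟨(|B| + 1) / ℓ x ^ 2, by positivity, fun v hv => ?_⟩
      by_cases h : H v v ≤ 0
      · have h1 : ℓ x ^ 2 ≤ ℓ v ^ 2 := hmin ⟨hv, h⟩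
        have h2 : |H v v| ≤ B := hB _ ⟨v, hv, rfl⟩
        have h3 : (|B| + 1) ≤ (|B| + 1) / ℓ x ^ 2 * ℓ v ^ 2 := by
          rw [div_mul_eq_mul_div, le_div_iff₀ hm]
          gcongr
        have := neg_abs_le (H v v)
        have := le_abs_self B
        linarith
      · have : 0 < H v v := not_le.1 h
        positivity
  obtain ⟨M, hM0, hM⟩ := hM
  have hc : ∃ c > 0, ∀ v ∈ sphere (0 : E) 1, c ≤ H v v + M * ℓ v ^ 2 := by
    rcases (sphere (0 : E) 1).eq_empty_or_nonempty with he | hne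
    · exact ⟨1, one_pos, fun v hv => absurd (he ▸ hv) (Set.notMem_empty v)⟩
    · obtain ⟨x, hx, hmin⟩ := hK.exists_isMinOn hne
        (f := fun v => H v v + M * ℓ v ^ 2) (by fun_prop)
      exact ⟨_, hM x hx, fun v hv => hmin hv⟩
  obtain ⟨c, hc0, hc⟩ := hc
  refine ⟨c, hc0, M, hM0, fun v => ?_⟩
  rcases eq_or_ne v 0 with rfl | hv
  · simp
  have hv' : 0 < ‖v‖ := norm_pos_iff.2 hv
  have := hc (‖v‖⁻¹ • v) (by simp [norm_smul, hv'.ne'])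
  have h2 : H v v + M * ℓ v ^ 2 = ‖v‖ ^ 2 *
      (H (‖v‖⁻¹ • v) (‖v‖⁻¹ • v) + M * ℓ (‖v‖⁻¹ • v) ^ 2) := by
    simp only [map_smul, _root_.smul_apply, smul_eq_mul]
    field_simp
  rw [h2, mul_comm c]
  gcongr

/-- A bounded strongly convex domain lies on the positive side of a paraboloid touching its
boundary at a given point. -/
theorem exists_paraboloid_support [FiniteDimensional ℝ E] {Ω : Set E} (hΩo : IsOpen Ω)
    (hΩc : Convex ℝ Ω) (hΩb : Bornology.IsBounded Ω) {ρ : E → ℝ} (hρ : ContDiff ℝ 2 ρ)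
    (hΩρ : ∀ z ∈ Ω, ρ z < 0) {p : E} (hp : p ∈ closure Ω) (hρp : ρ p = 0)
    (hpos : ∀ v, v ≠ 0 → fderiv ℝ ρ p v = 0 → 0 < fderiv ℝ (fderiv ℝ ρ) p v v) :
    ∃ c > 0, ∀ z ∈ Ω, c * ‖z - p‖ ^ 2 ≤ -fderiv ℝ ρ p (z - p) := by
  obtain ⟨c, hc, M, hM, hcM⟩ := exists_quadratic_add_sq_ge _ _ hpos
  obtain ⟨r, hr, hT⟩ := exists_taylor_two_bound hρ p (η := c / 4) (by positivity)
  set ℓ := fderiv ℝ ρ p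
  have hsmall : ∀ᶠ w in 𝓝 (0 : E), |ℓ w| < 1 / M := by
    have : Tendsto (fun w => |ℓ w|) (𝓝 0) (𝓝 |ℓ 0|) := (by fun_prop : Continuous _).tendsto 0
    exact this.eventually (gt_mem_nhds (by simpa using hM))
  obtain ⟨r', hr', hs⟩ := Metric.eventually_nhds_iff_ball.1 hsmall
  set δ := min r r' with hδ
  have hδ0 : 0 < δ := lt_min hr hr'
  have hlocal : ∀ w, ‖w‖ < δ → p + w ∈ Ω → c / 6 * ‖w‖ ^ 2 ≤ -ℓ w := by
    intro w hw hz
    have h1 := (abs_le.1 (hT w (hw.trans_le (min_le_left _ _)))).1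
    have h2 := hcM w
    have h3 := hΩρ _ hz
    have h4 := abs_lt.1 (hs w (by simpa using hw.trans_le (min_le_right _ _)))
    rw [hρp] at h1
    have h5 : 0 ≤ ‖w‖ ^ 2 := by positivity
    have h6 : c / 4 * ‖w‖ ^ 2 ≤ -ℓ w + M / 2 * ℓ w ^ 2 := by nlinarith
    have hMl : |M * ℓ w| ≤ 1 := by
      rw [abs_mul, abs_of_pos hM]
      have : |ℓ w| ≤ 1 / M := abs_le.2 ⟨h4.1.le, h4.2.le⟩
      calc _ ≤ M * (1 / M) := by gcongr
        _ = 1 := by field_simp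
    have h7 := abs_le.1 hMl
    by_cases hneg : 0 ≤ -ℓ w
    · nlinarith
    · push Not at hneg
      nlinarith [mul_nonneg hc.le h5]
  obtain ⟨R, hR0, hR⟩ : ∃ R > 0, ∀ z ∈ Ω, ‖z - p‖ ≤ R := by
    obtain ⟨R, hR⟩ := hΩb.exists_norm_le
    refine ⟨|R| + ‖p‖ + 1, by positivity, fun z hz => ?_⟩
    have := norm_sub_le z p
    have := hR z hz
    have := le_abs_self R
    linarith
  set τ := min 1 (δ / (2 * R)) with hτ
  have hτ0 : 0 < τ := lt_min one_pos (by positivity)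
  have hτ1 : τ ≤ 1 := min_le_left _ _
  refine ⟨c / 6 * τ, by positivity, fun z hz => ?_⟩
  have hmem : p + τ • (z - p) ∈ Ω := by
    have := hΩc.combo_closure_interior_mem_interior hp (hΩo.interior_eq.symm ▸ hz)
      (a := 1 - τ) (b := τ) (by linarith) hτ0 (by ring)
    rw [hΩo.interior_eq] at this
    convert this using 1
    module
  have hnorm : ‖τ • (z - p)‖ = τ * ‖z - p‖ := by rw [norm_smul, Real.norm_of_nonneg hτ0.le]
  have hlt : ‖τ • (z - p)‖ < δ := by
    rw [hnorm]
    calc τ * ‖z - p‖ ≤ δ / (2 * R) * R := by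
          gcongr
          · exact min_le_right _ _
          · exact hR z hz
      _ = δ / 2 := by field_simp
      _ < δ := by linarith
  have := hlocal _ hlt hmem
  rw [hnorm, map_smul, smul_eq_mul] at this
  have h8 : τ * (c / 6 * τ * ‖z - p‖ ^ 2) ≤ τ * (-ℓ (z - p)) := by linarith
  exact le_of_mul_le_mul_left h8 hτ0

end RealTaylor

section HolomorphicTaylor

variable {E : Type*} [NormedAddCommGroup E] [NormedSpace ℂ E]

/-- Quadratic error in the first order expansion of a holomorphic function. -/
theorem exists_holomorphic_taylor_one_bound {f : E → ℂ} {U : Set E} (hU : IsOpen U)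
    (hf : DifferentiableOn ℂ f U) {s : E} (hs : s ∈ U) :
    ∃ C > 0, ∃ r > 0, ∀ w, ‖w‖ < r → ‖f (s + w) - f s - fderiv ℂ f s w‖ ≤ C * ‖w‖ ^ 2 := by
  have hc : ContinuousAt f s := (hf.differentiableAt (hU.mem_nhds hs)).continuousAt
  have hev : ∀ᶠ z in 𝓝 s, z ∈ U ∧ ‖f z - f s‖ < 1 :=
    Filter.Eventually.and (hU.mem_nhds hs)
      (by simpa [dist_eq_norm] using hc.eventually (ball_mem_nhds (f s) one_pos))
  obtain ⟨r, hr, hb⟩ := Metric.eventually_nhds_iff_ball.1 hev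
  set D := fderiv ℂ f s
  set M := 1 + ‖D‖ * r
  have hM : 0 < M := by positivity
  refine ⟨(M + 1) / r / r, by positivity, r, hr, fun w hw => ?_⟩
  rcases eq_or_ne w 0 with rfl | hw0
  · simp
  have hwn : 0 < ‖w‖ := norm_pos_iff.2 hw0
  set e : E := ((‖w‖⁻¹ : ℝ) : ℂ) • w with he
  have hen : ‖e‖ = 1 := by
    rw [he, norm_smul]; simp [hwn.ne']
  have hin : ∀ ζ ∈ ball (0 : ℂ) r, s + ζ • e ∈ ball s r := by
    intro ζ hζ
    simpa [norm_smul, hen] using hζ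
  set g : ℂ → ℂ := fun ζ => f (s + ζ • e) - f s - D (ζ • e) with hg
  have hgd : DifferentiableOn ℂ g (ball 0 r) := by
    intro ζ hζ
    have h1 : DifferentiableAt ℂ f (s + ζ • e) :=
      hf.differentiableAt (hU.mem_nhds (hb _ (hin ζ hζ)).1)
    have h2 : DifferentiableAt ℂ (fun ζ : ℂ => s + ζ • e) ζ := by fun_prop
    have h3 : DifferentiableAt ℂ (fun ζ : ℂ => f (s + ζ • e)) ζ :=
      DifferentiableAt.comp ζ (g := f) (f := fun ζ : ℂ => s + ζ • e) h1 h2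
    have h4 : DifferentiableAt ℂ (fun ζ : ℂ => D (ζ • e)) ζ := by fun_prop
    exact ((h3.sub_const _).sub h4).differentiableWithinAt
  have hg0 : g 0 = 0 := by simp [hg]
  have hgbd : ∀ ζ ∈ ball (0 : ℂ) r, ‖g ζ‖ < M := by
    intro ζ hζ
    have h1 := (hb _ (hin ζ hζ)).2
    have h2 : ‖D (ζ • e)‖ ≤ ‖D‖ * r := by
      refine (D.le_opNorm _).trans ?_
      gcongr
      rw [norm_smul, hen, mul_one]
      exact (by simpa using hζ : ‖ζ‖ < r).le
    calc ‖g ζ‖ ≤ ‖f (s + ζ • e) - f s‖ + ‖D (ζ • e)‖ := norm_sub_le _ _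
      _ < M := by linarith
  have hgder : HasDerivAt g 0 0 := by
    have h1 : HasFDerivAt f D (s + (0 : ℂ) • e) := by
      simpa using (hf.differentiableAt (hU.mem_nhds hs)).hasFDerivAt
    have h2 : HasDerivAt (fun ζ : ℂ => ζ • e) e 0 := by
      simpa using (hasDerivAt_id (0 : ℂ)).smul_const e
    have h3 := h1.comp_hasDerivAt (0 : ℂ) (h2.const_add s)
    have h4 := (h3.sub_const (f s)).sub (D.hasFDerivAt.comp_hasDerivAt (0 : ℂ) h2)
    have h5 : HasDerivAt g (D e - D e) 0 := h4
    simpa using h5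
  have hball : ball (0 : ℂ) r ∈ 𝓝 (0 : ℂ) := ball_mem_nhds _ hr
  set d := dslope g 0
  have hd0 : d 0 = 0 := by simp [d, hgder.deriv]
  have hdd : DifferentiableOn ℂ d (ball 0 r) := (Complex.differentiableOn_dslope hball).2 hgd
  have hdb : ∀ ζ ∈ ball (0 : ℂ) r, ‖d ζ‖ ≤ M / r := by
    intro ζ hζ
    exact Complex.norm_dslope_le_div_of_mapsTo_ball hgd
      (fun ξ hξ => by simpa [hg0] using (hgbd ξ hξ).le) hζ
  have hwball : ((‖w‖ : ℝ) : ℂ) ∈ ball (0 : ℂ) r := by simpa using hw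
  have hdd2 := Complex.norm_dslope_le_div_of_mapsTo_ball hdd
      (R₂ := (M + 1) / r) (fun ξ hξ => by
        have := hdb ξ hξ
        simp only [hd0, mem_closedBall, dist_zero_right]
        refine this.trans ?_
        gcongr
        linarith) hwball
  have hwc : ((‖w‖ : ℝ) : ℂ) ≠ 0 := by exact_mod_cast hwn.ne'
  rw [dslope_of_ne _ hwc, slope_def_field, hd0, sub_zero, sub_zero,
    show d ((‖w‖ : ℝ) : ℂ) = _ from dslope_of_ne _ hwc, slope_def_field, hg0,
    sub_zero, sub_zero, norm_div, norm_div] at hdd2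
  have hgw : g ((‖w‖ : ℝ) : ℂ) = f (s + w) - f s - D w := by
    have : ((‖w‖ : ℝ) : ℂ) • e = w := by
      rw [he, smul_smul]
      simp [hwn.ne']
    simp only [hg, this]
  rw [hgw] at hdd2
  simp only [Complex.norm_real, norm_norm] at hdd2
  rw [div_le_iff₀ hwn, div_le_iff₀ hwn] at hdd2
  linarith

end HolomorphicTaylor

section SingularImage

variable {E : Type*} [NormedAddCommGroup E] [NormedSpace ℂ E] [NormedSpace ℝ E]
  [IsScalarTower ℝ ℂ E] [FiniteDimensional ℝ E]

/-- A real rank one perturbation of a singular complex-linear map is singular. -/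
theorem det_comp_add_smulRight_eq_zero [FiniteDimensional ℂ E] {D : E →L[ℂ] E}
    (hD : LinearMap.det D.toLinearMap = 0) (A : E →L[ℝ] E) (ℓ : E →L[ℝ] ℝ) (ν : E) :
    ((D.restrictScalars ℝ).comp A + ℓ.smulRight ν).det = 0 := by
  set B := (D.restrictScalars ℝ).comp A + ℓ.smulRight ν with hB
  by_contra hne
  have hsurj : Function.Surjective B := by
    have hu : IsUnit (B : E →ₗ[ℝ] E) := by
      rw [LinearMap.isUnit_iff_isUnit_det]
      exact isUnit_iff_ne_zero.2 hne
    exact ((Module.End.isUnit_iff _).1 hu).2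
  have hrange : LinearMap.range D.toLinearMap < ⊤ := by
    refine lt_top_iff_ne_top.2 fun h => ?_
    have hu : IsUnit D.toLinearMap := by
      rw [LinearMap.isUnit_iff_range_eq_top]
      exact h
    rw [LinearMap.isUnit_iff_isUnit_det, hD] at hu
    exact not_isUnit_zero hu
  obtain ⟨f, hf0, hf⟩ := Submodule.exists_le_ker_of_lt_top _ hrange
  have hfD : ∀ x, f (D x) = 0 := fun x => hf ⟨x, rfl⟩
  have hfB : ∀ x, f (B x) = (ℓ x : ℂ) * f ν := by
    intro x
    simp only [hB, add_apply, ContinuousLinearMap.comp_apply,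
      ContinuousLinearMap.coe_restrictScalars', ContinuousLinearMap.smulRight_apply, map_add, hfD,
      zero_add]
    rw [← algebraMap_smul ℂ (ℓ x) ν, map_smul]
    rfl
  obtain ⟨x, hx⟩ : ∃ x, f x ≠ 0 := by
    by_contra! h
    exact hf0 (LinearMap.ext h)
  by_cases hν : f ν = 0
  · obtain ⟨y, rfl⟩ := hsurj x
    rw [hfB, hν, mul_zero] at hx
    exact hx rfl
  · obtain ⟨y, hy⟩ := hsurj (Complex.I • ν)
    have h1 := hfB y
    rw [hy, map_smul, smul_eq_mul] at h1
    have h2 := mul_right_cancel₀ hν h1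
    simpa using congrArg Complex.im h2

variable [MeasurableSpace E] [BorelSpace E] (μ : Measure E) [μ.IsAddHaarMeasure]

/-- If `φ` is holomorphic with singular differential along a subset `S` of a smooth real
hypersurface, then the cylinder over `φ '' S` in any direction is a null set. -/
theorem measure_image_add_line_eq_zero [FiniteDimensional ℂ E] {ρ : E → ℝ} (hρ : ContDiff ℝ 1 ρ)
    {φ : E → E} {S : Set E} (hSρ : ∀ s ∈ S, ρ s = 0) (hSd : ∀ s ∈ S, fderiv ℝ ρ s ≠ 0)
    (hφ : ∀ s ∈ S, DifferentiableAt ℂ φ s)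
    (hdet : ∀ s ∈ S, LinearMap.det (fderiv ℂ φ s).toLinearMap = 0) (ν : E) :
    μ {y | ∃ s ∈ S, ∃ t : ℝ, y = φ s + t • ν} = 0 := by
  have key : ∀ q ∈ S, ∃ W ∈ 𝓝 q, μ {y | ∃ s ∈ S ∩ W, ∃ t : ℝ, y = φ s + t • ν} = 0 := by
    intro q hq
    obtain ⟨u, hu⟩ : ∃ u, fderiv ℝ ρ q u = 1 := by
      obtain ⟨v, hv⟩ : ∃ v, fderiv ℝ ρ q v ≠ 0 := by
        by_contra! h
        exact hSd q hq (ContinuousLinearMap.ext h)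
      exact ⟨(fderiv ℝ ρ q v)⁻¹ • v, by simp [hv]⟩
    set ℓ := fderiv ℝ ρ q with hℓ
    set G : E → E := fun z => z - ℓ z • u + ρ z • u with hG
    have hGc : ContDiff ℝ 1 G := by
      have : ContDiff ℝ 1 fun z => ℓ z := ℓ.contDiff
      fun_prop
    have hG' : HasFDerivAt G ((ContinuousLinearEquiv.refl ℝ E : E ≃L[ℝ] E) : E →L[ℝ] E) q := by
      have h1 : HasFDerivAt ρ ℓ q := (hρ.differentiable one_ne_zero q).hasFDerivAt
      have h2 := ((hasFDerivAt_id (𝕜 := ℝ) q).sub (ℓ.hasFDerivAt.smul_const u)).add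
        (h1.smul_const u)
      refine h2.congr_fderiv ?_
      ext x
      simp
    set g := hGc.contDiffAt.localInverse hG' one_ne_zero with hg
    have hstrict : HasStrictFDerivAt G
        ((ContinuousLinearEquiv.refl ℝ E : E ≃L[ℝ] E) : E →L[ℝ] E) q :=
      hGc.contDiffAt.hasStrictFDerivAt' hG' one_ne_zero
    have hleft : ∀ᶠ z in 𝓝 q, g (G z) = z := hstrict.eventually_left_inverse
    have hgc : ContDiffAt ℝ 1 g (G q) := hGc.contDiffAt.to_localInverse hG' one_ne_zero
    have hgd : ∀ᶠ z in 𝓝 q, DifferentiableAt ℝ g (G z) := by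
      have h1 : ∀ᶠ y in 𝓝 (G q), ContDiffAt ℝ 1 g y := hgc.eventually (by simp)
      exact (hGc.continuous.tendsto q).eventually
        (h1.mono fun y hy => hy.differentiableAt one_ne_zero)
    refine ⟨_, hleft.and hgd, ?_⟩
    set Ψ : E → E := fun y => φ (g (y - ℓ y • u)) + ℓ y • ν with hΨ
    set T : Set E := {y | ∃ s ∈ S, (g (G s) = s ∧ DifferentiableAt ℝ g (G s)) ∧
      ∃ t : ℝ, y = G s + t • u} with hT
    have hproj : ∀ s ∈ S, ∀ t : ℝ, ℓ (G s + t • u) = t := by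
      intro s hs t
      simp [hG, hu, hSρ s hs]
    have hder : ∀ y ∈ T, ∃ B : E →L[ℝ] E, HasFDerivAt Ψ B y ∧ B.det = 0 := by
      rintro y ⟨s, hs, ⟨hgs, hgds⟩, t, rfl⟩
      have hy : G s + t • u - ℓ (G s + t • u) • u = G s := by rw [hproj s hs t]; simp
      have h1 : HasFDerivAt (fun y => y - ℓ y • u)
          (ContinuousLinearMap.id ℝ E - ℓ.smulRight u) (G s + t • u) :=
        (hasFDerivAt_id _).sub (ℓ.hasFDerivAt.smul_const u)
      have h2 : HasFDerivAt g (fderiv ℝ g (G s)) (G s + t • u - ℓ (G s + t • u) • u) := by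
        rw [hy]; exact hgds.hasFDerivAt
      have h3 := h2.comp (G s + t • u) h1
      have h4 : HasFDerivAt φ ((fderiv ℂ φ s).restrictScalars ℝ)
          (g (G s + t • u - ℓ (G s + t • u) • u)) := by
        rw [hy, hgs]; exact (hφ s hs).hasFDerivAt.restrictScalars ℝ
      have h5 := (h4.comp (G s + t • u) h3).add (ℓ.hasFDerivAt.smul_const ν)
      exact ⟨_, h5, det_comp_add_smulRight_eq_zero (hdet s hs) _ _ _⟩
    choose! B hB hBdet using hder
    refine measure_mono_null ?_ (addHaar_image_eq_zero_of_det_fderivWithin_eq_zero μ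
      (fun y hy => (hB y hy).hasFDerivWithinAt) hBdet)
    rintro y ⟨s, ⟨hs, hgs⟩, t, rfl⟩
    refine ⟨G s + t • u, ⟨s, hs, hgs, t, rfl⟩, ?_⟩
    simp only [hΨ, hproj s hs t]
    simp [hgs.1]
  choose! W hW hWμ using key
  obtain ⟨c, hcS, hc, hcov⟩ := TopologicalSpace.countable_cover_nhdsWithin
    (fun q hq => mem_nhdsWithin_of_mem_nhds (hW q hq))
  refine measure_mono_null ?_ ((measure_biUnion_null_iff hc).2 fun q hq => hWμ q (hcS hq))
  rintro y ⟨s, hs, t, rfl⟩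
  obtain ⟨q, hq, hsq⟩ := mem_iUnion₂.1 (hcov hs)
  exact mem_iUnion₂.2 ⟨q, hq, s, ⟨hs, hsq⟩, t, rfl⟩

end SingularImage

/-- A cylinder over a neighbourhood of `p` in the hypersurface `ρ = 0`, in a transversal
direction, has positive measure. -/
theorem measure_add_line_pos {E : Type*} [NormedAddCommGroup E] [NormedSpace ℝ E]
    [MeasurableSpace E] (μ : Measure E) [μ.IsOpenPosMeasure] {ρ : E → ℝ}
    (hρ : Continuous ρ) {p ν : E} (hp : ρ p = 0) (hd : HasFDerivAt ρ (fderiv ℝ ρ p) p)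
    (hν : 0 < fderiv ℝ ρ p ν) {V : Set E} {δ : ℝ} (hδ : 0 < δ)
    (hV : ∀ x, ρ x = 0 → dist x p < δ → x ∈ V) :
    0 < μ {y | ∃ x ∈ V, ∃ t : ℝ, y = x + t • ν} := by
  have hderiv : HasDerivAt (fun t : ℝ => ρ (p + t • ν)) (fderiv ℝ ρ p ν) 0 := by
    have h1 : HasDerivAt (fun t : ℝ => p + t • ν) ν 0 := by
      simpa using ((hasDerivAt_id (0 : ℝ)).smul_const ν).const_add p
    have hd' : HasFDerivAt ρ (fderiv ℝ ρ p) (p + (0 : ℝ) • ν) := by simpa using hd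
    exact hd'.comp_hasDerivAt (0 : ℝ) h1
  have hslope := hasDerivAt_iff_tendsto_slope.1 hderiv
  have hpos : ∀ᶠ t in 𝓝[≠] (0 : ℝ), 0 < slope (fun t : ℝ => ρ (p + t • ν)) 0 t :=
    hslope.eventually (lt_mem_nhds hν)
  rw [eventually_nhdsWithin_iff, Metric.eventually_nhds_iff_ball] at hpos
  obtain ⟨r, hr, hb⟩ := hpos
  obtain ⟨τ, hτ0, hτr, hτδ⟩ : ∃ τ > 0, τ < r ∧ τ * ‖ν‖ < δ / 2 := by
    refine ⟨min (r / 2) (δ / (4 * (‖ν‖ + 1))), lt_min (by positivity) (by positivity),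
      (min_le_left _ _).trans_lt (by linarith), ?_⟩
    calc min (r / 2) (δ / (4 * (‖ν‖ + 1))) * ‖ν‖ ≤ δ / (4 * (‖ν‖ + 1)) * (‖ν‖ + 1) := by
          gcongr
          · exact min_le_right _ _
          · linarith
      _ = δ / 4 := by field_simp
      _ < δ / 2 := by linarith
  have hplus : 0 < ρ (p + τ • ν) := by
    have := hb τ (by simpa [abs_of_pos hτ0] using hτr) hτ0.ne'
    rw [slope_def_field] at this
    simp only [zero_smul, add_zero, hp, sub_zero] at this
    exact (div_pos_iff_of_pos_right hτ0).1 this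
  have hminus : ρ (p + (-τ) • ν) < 0 := by
    have := hb (-τ) (by simpa [abs_of_pos hτ0] using hτr) (neg_ne_zero.2 hτ0.ne')
    rw [slope_def_field] at this
    simp only [zero_smul, add_zero, hp, sub_zero, div_neg] at this
    have h2 := neg_pos.1 this
    by_contra h
    exact h2.not_ge (div_nonneg (not_lt.1 h) hτ0.le)
  have hev : ∀ᶠ y in 𝓝 p, 0 < ρ (y + τ • ν) ∧ ρ (y + (-τ) • ν) < 0 ∧ dist y p < δ / 2 := by
    have c1 : Continuous fun y => ρ (y + τ • ν) := by fun_prop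
    have c2 : Continuous fun y => ρ (y + (-τ) • ν) := by fun_prop
    exact ((c1.tendsto p).eventually (lt_mem_nhds hplus)).and
      (((c2.tendsto p).eventually (gt_mem_nhds hminus)).and
        (ball_mem_nhds p (by positivity)))
  refine MeasureTheory.Measure.measure_pos_of_mem_nhds μ (x := p) (Filter.mem_of_superset hev ?_)
  rintro y ⟨h1, h2, h3⟩
  have hc : Continuous fun t : ℝ => ρ (y + t • ν) := by fun_prop
  obtain ⟨t, ht, hty⟩ := intermediate_value_Icc (by linarith : -τ ≤ τ) hc.continuousOn
    ⟨h2.le, h1.le⟩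
  refine ⟨y + t • ν, hV _ hty ?_, -t, by simp⟩
  have h4 : ‖t • ν‖ ≤ τ * ‖ν‖ := by
    rw [norm_smul]
    gcongr
    exact abs_le.2 ht
  calc dist (y + t • ν) p ≤ dist (y + t • ν) y + dist y p := dist_triangle _ _ _
    _ < δ := by
      rw [dist_eq_norm, add_sub_cancel_left]
      linarith

section AnisotropicScaling

variable {E : Type*} [NormedAddCommGroup E] [NormedSpace ℂ E]

/-- The complex-linear map scaling by `t²` in the direction `u` and by `t` along `ker L`,
when `L u = 1`. -/
def anisoScale (L : E →L[ℂ] ℂ) (u : E) (t : ℝ) : E →L[ℂ] E :=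
  (t : ℂ) • (ContinuousLinearMap.id ℂ E + L.smulRight (((t : ℂ) - 1) • u))

theorem anisoScale_apply (L : E →L[ℂ] ℂ) (u : E) (t : ℝ) (v : E) :
    anisoScale L u t v = (t : ℂ) • (v + (L v * ((t : ℂ) - 1)) • u) := by
  simp [anisoScale, smul_smul, -Complex.coe_smul]

theorem apply_anisoScale {L : E →L[ℂ] ℂ} {u : E} (hu : L u = 1) (t : ℝ) (v : E) :
    L (anisoScale L u t v) = (t : ℂ) ^ 2 * L v := by
  simp [anisoScale_apply, hu]; ring

theorem norm_anisoScale_le (L : E →L[ℂ] ℂ) (u : E) {t : ℝ} (ht : 0 ≤ t) (ht1 : t ≤ 1) (v : E) :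
    ‖anisoScale L u t v‖ ≤ t * ((1 + ‖L‖ * ‖u‖) * ‖v‖) := by
  rw [anisoScale_apply, norm_smul, Complex.norm_real, Real.norm_of_nonneg ht]
  gcongr
  refine (norm_add_le _ _).trans ?_
  rw [norm_smul, norm_mul]
  have h1 : ‖(t : ℂ) - 1‖ ≤ 1 := by
    rw [← Complex.ofReal_one, ← Complex.ofReal_sub, Complex.norm_real, Real.norm_eq_abs,
      abs_le]
    constructor <;> linarith
  calc ‖v‖ + ‖L v‖ * ‖(t : ℂ) - 1‖ * ‖u‖ ≤ ‖v‖ + (‖L‖ * ‖v‖) * 1 * ‖u‖ := by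
        gcongr
        exact L.le_opNorm v
    _ = _ := by ring

theorem le_norm_anisoScale (L : E →L[ℂ] ℂ) (u : E) {t : ℝ} (ht : 0 < t) (ht1 : t ≤ 1) (v : E) :
    t * (‖v‖ - ‖L v‖ * ‖u‖) ≤ ‖anisoScale L u t v‖ := by
  rw [anisoScale_apply, norm_smul, Complex.norm_real, Real.norm_of_nonneg ht.le]
  gcongr
  have h1 : ‖(t : ℂ) - 1‖ ≤ 1 := by
    rw [← Complex.ofReal_one, ← Complex.ofReal_sub, Complex.norm_real, Real.norm_eq_abs,
      abs_le]
    constructor <;> linarith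
  have h2 : ‖v‖ ≤ ‖v + (L v * ((t : ℂ) - 1)) • u‖ + ‖(L v * ((t : ℂ) - 1)) • u‖ := by
    simpa using norm_sub_le (v + (L v * ((t : ℂ) - 1)) • u) ((L v * ((t : ℂ) - 1)) • u)
  have h3 : ‖(L v * ((t : ℂ) - 1)) • u‖ ≤ ‖L v‖ * ‖u‖ := by
    rw [norm_smul, norm_mul]
    calc ‖L v‖ * ‖(t : ℂ) - 1‖ * ‖u‖ ≤ ‖L v‖ * 1 * ‖u‖ := by gcongr
      _ = _ := by ring
  linarith

theorem injective_add_anisoScale {L : E →L[ℂ] ℂ} {u : E} (hu : L u = 1) {t : ℝ} (ht : t ≠ 0)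
    (p : E) : Function.Injective fun v => p + anisoScale L u t v := by
  have htc : (t : ℂ) ≠ 0 := by exact_mod_cast ht
  intro v w hvw
  have h1 : anisoScale L u t (v - w) = 0 := by
    rw [map_sub, sub_eq_zero]
    exact add_left_cancel hvw
  have h2 := congrArg L h1
  rw [apply_anisoScale hu, map_zero] at h2
  have h3 : L (v - w) = 0 := by simpa [htc] using h2
  rw [anisoScale_apply, h3] at h1
  rw [zero_mul, zero_smul, add_zero] at h1
  exact sub_eq_zero.1 ((smul_eq_zero.1 h1).resolve_left htc)

theorem surjective_add_anisoScale [FiniteDimensional ℂ E] {L : E →L[ℂ] ℂ} {u : E}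
    (hu : L u = 1) {t : ℝ} (ht : t ≠ 0) (p : E) : Function.Surjective fun v => p + anisoScale L u t v := by
  have hinj : Function.Injective (anisoScale L u t).toLinearMap := by
    have := injective_add_anisoScale hu ht 0
    simpa using this
  intro z
  obtain ⟨v, hv⟩ := LinearMap.injective_iff_surjective.1 hinj (z - p)
  exact ⟨v, by simp only [ContinuousLinearMap.coe_coe] at hv; simp [hv]⟩

variable [NormedSpace ℝ E] [IsScalarTower ℝ ℂ E] [FiniteDimensional ℂ E]

theorem det_anisoScale {L : E →L[ℂ] ℂ} {u : E} (hu : L u = 1) (t : ℝ) :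
    ((anisoScale L u t).restrictScalars ℝ).det = t ^ (2 * (Module.finrank ℂ E + 1)) := by
  have h1 : (anisoScale L u t).toLinearMap =
      (t : ℂ) • LinearMap.transvection L.toLinearMap (((t : ℂ) - 1) • u) := by
    ext v
    simp [anisoScale_apply, LinearMap.transvection.apply, smul_smul, -Complex.coe_smul]
  have h2 : LinearMap.det (anisoScale L u t).toLinearMap
      = ((t ^ (Module.finrank ℂ E + 1) : ℝ) : ℂ) := by
    rw [h1, LinearMap.det_smul, LinearMap.transvection.det]
    simp [hu]
    ring
  have h3 : ((anisoScale L u t).restrictScalars ℝ).det =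
      LinearMap.det ((anisoScale L u t).toLinearMap.restrictScalars ℝ) := rfl
  rw [h3, LinearMap.det_restrictScalars, h2, Algebra.norm_complex_apply, Complex.normSq_ofReal]
  ring

variable [FiniteDimensional ℝ E] [MeasurableSpace E] [BorelSpace E] (μ : Measure E)
  [μ.IsAddHaarMeasure]

theorem setLIntegral_image_anisoScale {L : E →L[ℂ] ℂ} {u : E} (hu : L u = 1) {t : ℝ}
    (ht : t ≠ 0) (p : E) {A : Set E} (hA : MeasurableSet A) (F : E → ENNReal) :
    ∫⁻ z in (fun v => p + anisoScale L u t v) '' A, F z ∂μ =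
      ∫⁻ v in A, ENNReal.ofReal (t ^ (2 * (Module.finrank ℂ E + 1))) *
        F (p + anisoScale L u t v) ∂μ := by
  have hd : ∀ v ∈ A, HasFDerivWithinAt (fun v => p + anisoScale L u t v)
      ((anisoScale L u t).restrictScalars ℝ) A v := fun v _ =>
    (((anisoScale L u t).restrictScalars ℝ).hasFDerivAt.const_add p).hasFDerivWithinAt
  rw [lintegral_image_eq_lintegral_abs_det_fderiv_mul μ hA hd
    (injective_add_anisoScale hu ht p).injOn, det_anisoScale hu, abs_of_nonneg]
  rw [pow_mul]
  positivity

end AnisotropicScaling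

section PeakFunction

variable {E : Type*} [NormedAddCommGroup E] [NormedSpace ℂ E] [NormedSpace ℝ E]
  [IsScalarTower ℝ ℂ E] [FiniteDimensional ℂ E] [FiniteDimensional ℝ E] [MeasurableSpace E]
  [BorelSpace E] (μ : Measure E) [μ.IsAddHaarMeasure]

theorem sq_le_norm_add_sq {x : ℂ} (hx : 0 ≤ x.re) (t : ℝ) : t ^ 2 ≤ ‖x + (t : ℂ) ^ 2‖ := by
  have := Complex.re_le_norm (x + (t : ℂ) ^ 2)
  have h2 : (x + (t : ℂ) ^ 2).re = x.re + t ^ 2 := by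
    rw [Complex.add_re, ← Complex.ofReal_pow, Complex.ofReal_re]
  linarith

theorem norm_peak_sq {x : ℂ} {t : ℝ} (ht : 0 < t) (N : ℕ) :
    ‖((t : ℂ) / (x + (t : ℂ) ^ 2)) ^ N‖ ^ 2 = (t / ‖x + (t : ℂ) ^ 2‖) ^ (2 * N) := by
  rw [norm_pow, norm_div, Complex.norm_real, Real.norm_of_nonneg ht.le, ← pow_mul, mul_comm]

/-- The normalised peak functions at the contact point of a paraboloid are bounded in `L²`. -/
theorem exists_lintegral_peak_le {Ω : Set E} (hΩ : MeasurableSet Ω) {L : E →L[ℂ] ℂ} (hL : L ≠ 0)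
    (p : E) {c : ℝ} (hc : 0 < c) (hΩL : ∀ z ∈ Ω, c * ‖z - p‖ ^ 2 ≤ (L (z - p)).re) :
    ∃ C : ℝ, 0 ≤ C ∧ ∀ t : ℝ, 0 < t → t ≤ 1 →
      ∫⁻ z in Ω, ENNReal.ofReal
        (‖((t : ℂ) / (L (z - p) + (t : ℂ) ^ 2)) ^ (Module.finrank ℂ E + 1)‖ ^ 2) ∂μ
        ≤ ENNReal.ofReal C := by
  obtain ⟨u, hu⟩ : ∃ u, L u = 1 := by
    obtain ⟨v, hv⟩ : ∃ v, L v ≠ 0 := by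
      by_contra! h
      exact hL (ContinuousLinearMap.ext h)
    exact ⟨(L v)⁻¹ • v, by simp [hv]⟩
  set N := Module.finrank ℂ E + 1 with hN
  set K := 1 + (1 / c + 1 + ‖u‖) with hK
  have hK0 : 0 < K := by positivity
  set r : ℝ := 2 * N with hr
  have hfin : (Module.finrank ℝ E : ℝ) < r := by
    rw [← Module.finrank_mul_finrank ℝ ℂ E, Complex.finrank_real_complex, hr, hN]
    push_cast
    linarith
  have hint : ∫⁻ v, ENNReal.ofReal ((1 + ‖v‖) ^ (-r)) ∂μ ≠ ⊤ :=
    (finite_integral_one_add_norm hfin).ne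
  set I := ∫⁻ v, ENNReal.ofReal ((1 + ‖v‖) ^ (-r)) ∂μ
  refine ⟨(ENNReal.ofReal (K ^ (2 * N)) * I).toReal, ENNReal.toReal_nonneg,
    fun t ht ht1 => ?_⟩
  rw [ENNReal.ofReal_toReal (ENNReal.mul_ne_top ENNReal.ofReal_ne_top hint)]
  set f := fun v => p + anisoScale L u t v with hf
  have hfm : Measurable f := by
    have : Continuous f := by fun_prop
    exact this.measurable
  have himg : Ω = f '' (f ⁻¹' Ω) :=
    (image_preimage_eq Ω (surjective_add_anisoScale hu ht.ne' p)).symm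
  rw [himg, setLIntegral_image_anisoScale μ hu ht.ne' p (hfm hΩ)]
  calc _ ≤ ∫⁻ v in f ⁻¹' Ω, ENNReal.ofReal (K ^ (2 * N)) * ENNReal.ofReal ((1 + ‖v‖) ^ (-r)) ∂μ := by
        refine setLIntegral_mono' (hfm hΩ) fun v hv => ?_
        have h1 := hΩL _ hv
        have h2 : p + anisoScale L u t v - p = anisoScale L u t v := by abel
        simp only [hf, h2, apply_anisoScale hu] at h1
        have h3 : ((t : ℂ) ^ 2 * L v).re = t ^ 2 * (L v).re := by
          rw [← Complex.ofReal_pow, Complex.re_ofReal_mul]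
        rw [h3] at h1
        have h4 := le_norm_anisoScale L u ht ht1 v
        have hre : 0 ≤ (L v).re := by
          by_contra h
          push Not at h
          have : t ^ 2 * (L v).re < 0 := mul_neg_of_pos_of_neg (by positivity) h
          have : 0 ≤ c * ‖anisoScale L u t v‖ ^ 2 := by positivity
          linarith
        have h5 : c * (‖anisoScale L u t v‖ / t) ^ 2 ≤ ‖L v‖ := by
          refine le_trans ?_ (Complex.re_le_norm _)
          rw [div_pow, mul_div_assoc', div_le_iff₀ (by positivity)]
          linarith
        have h6 : ‖v‖ ≤ ‖anisoScale L u t v‖ / t + ‖L v‖ * ‖u‖ := by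
          have : ‖v‖ - ‖L v‖ * ‖u‖ ≤ ‖anisoScale L u t v‖ / t := by
            rw [le_div_iff₀ ht]; linarith
          linarith
        set y := ‖anisoScale L u t v‖ / t
        have h7 : y ≤ 1 + ‖L v‖ / c := by
          have : y ^ 2 ≤ ‖L v‖ / c := by rw [le_div_iff₀ hc]; linarith
          nlinarith [sq_nonneg (y - 1)]
        have h8 : ‖L v‖ ≤ ‖L v + 1‖ ∧ 1 ≤ ‖L v + 1‖ := by
          constructor
          · rw [← sq_le_sq₀ (norm_nonneg _) (norm_nonneg _), ← Complex.normSq_eq_norm_sq,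
              ← Complex.normSq_eq_norm_sq, Complex.normSq_apply, Complex.normSq_apply]
            simp
            nlinarith
          · have := Complex.re_le_norm (L v + 1)
            simp at this
            linarith
        have h9 : 1 + ‖v‖ ≤ K * ‖L v + 1‖ := by
          have e1 : ‖L v‖ / c ≤ ‖L v + 1‖ / c := by gcongr; exact h8.1
          have e2 : ‖L v‖ * ‖u‖ ≤ ‖L v + 1‖ * ‖u‖ := by gcongr; exact h8.1
          have e3 : K * ‖L v + 1‖ = 2 * ‖L v + 1‖ + ‖L v + 1‖ / c + ‖L v + 1‖ * ‖u‖ := by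
            rw [hK]; ring
          linarith [h8.2]
        rw [← ENNReal.ofReal_mul (by rw [pow_mul]; positivity),
          ← ENNReal.ofReal_mul (by positivity)]
        refine ENNReal.ofReal_le_ofReal ?_
        rw [norm_peak_sq ht, h2, apply_anisoScale hu]
        have h10 : (t : ℂ) ^ 2 * L v + (t : ℂ) ^ 2 = ((t ^ 2 : ℝ) : ℂ) * (L v + 1) := by
          push_cast; ring
        rw [h10, norm_mul, Complex.norm_real, Real.norm_of_nonneg (by positivity),
          ← mul_pow, Real.rpow_neg (by positivity), hr,
          show (2 * (N : ℝ)) = ((2 * N : ℕ) : ℝ) by push_cast; ring, Real.rpow_natCast,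
          ← inv_pow, ← mul_pow]
        have hpos : 0 < ‖L v + 1‖ := by linarith [h8.2]
        refine pow_le_pow_left₀ (by positivity) ?_ _
        rw [show t * (t / (t ^ 2 * ‖L v + 1‖)) = 1 / ‖L v + 1‖ by field_simp,
          ← div_eq_mul_inv, div_le_div_iff₀ hpos (by positivity)]
        linarith
    _ ≤ ∫⁻ v, ENNReal.ofReal (K ^ (2 * N)) * ENNReal.ofReal ((1 + ‖v‖) ^ (-r)) ∂μ :=
        setLIntegral_le_lintegral _ _
    _ = _ := lintegral_const_mul' _ _ ENNReal.ofReal_ne_top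

/-- Peak functions composed with a map whose first order part `L` is normal to the boundary at
`s` keep a definite amount of mass on `Ω`. -/
theorem exists_lintegral_peak_comp_ge {Ω : Set E} {f : E → ℂ}
    (hf : ∀ z ∈ Ω, 0 ≤ (f z).re) {L : E →L[ℂ] ℂ} (hL : L ≠ 0) {s : E} {C r A : ℝ} (hC : 0 < C)
    (hr : 0 < r) (hA : 0 < A) (hfL : ∀ w, ‖w‖ < r → ‖f (s + w) - L w‖ ≤ C * ‖w‖ ^ 2)
    (hΩA : ∀ w, ‖w‖ < r → A * ‖w‖ ^ 2 < (L w).re → s + w ∈ Ω) :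
    ∃ c : ENNReal, 0 < c ∧ ∀ᶠ t : ℝ in 𝓝[>] 0,
      c ≤ ∫⁻ z in Ω, ENNReal.ofReal
        (‖((t : ℂ) / (f z + (t : ℂ) ^ 2)) ^ (Module.finrank ℂ E + 1)‖ ^ 2) ∂μ := by
  obtain ⟨u, hu⟩ : ∃ u, L u = 1 := by
    obtain ⟨v, hv⟩ : ∃ v, L v ≠ 0 := by
      by_contra! h
      exact hL (ContinuousLinearMap.ext h)
    exact ⟨(L v)⁻¹ • v, by simp [hv]⟩
  set N := Module.finrank ℂ E + 1 with hN
  set K := 1 + ‖L‖ * ‖u‖ with hK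
  have hK0 : 0 < K := by positivity
  set V : Set E := {v | ‖v‖ < 1} ∩ {v | A * (K ^ 2 * ‖v‖ ^ 2) < (L v).re} with hV
  have hVo : IsOpen V := by
    have hre : Continuous fun v => (L v).re := Complex.continuous_re.comp L.continuous
    exact (isOpen_lt (by fun_prop) (by fun_prop)).inter (isOpen_lt (by fun_prop) hre)
  have hVne : V.Nonempty := by
    set τ := 1 / (1 + ‖u‖ + A * K ^ 2 * ‖u‖ ^ 2 ) with hτ
    have hτ0 : 0 < τ := by positivity
    have hden : τ * (1 + ‖u‖ + A * K ^ 2 * ‖u‖ ^ 2) = 1 := by rw [hτ]; field_simp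
    have hsmall : τ * (A * K ^ 2 * ‖u‖ ^ 2) < 1 := by nlinarith [norm_nonneg u]
    have hnorm : ‖(τ : ℂ) • u‖ = τ * ‖u‖ := by
      rw [norm_smul, Complex.norm_real, Real.norm_of_nonneg hτ0.le]
    refine ⟨(τ : ℂ) • u, ?_, ?_⟩
    · have : 0 ≤ τ * (A * K ^ 2 * ‖u‖ ^ 2) := by positivity
      simp only [mem_ofPred_eq, hnorm]
      nlinarith
    · simp only [mem_ofPred_eq, hnorm, map_smul, hu, smul_eq_mul, mul_one, Complex.ofReal_re]
      nlinarith
  set C₂ := ‖L‖ + C * K ^ 2 + 1 with hC₂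
  have hC₂0 : 0 < C₂ := by positivity
  refine ⟨ENNReal.ofReal ((1 / C₂) ^ (2 * N)) * μ V, ?_, ?_⟩
  · exact ENNReal.mul_pos (by simpa using by positivity) (hVo.measure_pos μ hVne).ne'
  have hev : ∀ᶠ t : ℝ in 𝓝[>] 0, 0 < t ∧ t ≤ 1 ∧ t * K < r := by
    have h1 : ∀ᶠ t : ℝ in 𝓝 0, t < 1 ∧ t < r / K :=
      (gt_mem_nhds one_pos).and (gt_mem_nhds (by positivity))
    filter_upwards [self_mem_nhdsWithin, nhdsWithin_le_nhds h1] with t ht h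
    exact ⟨ht, h.1.le, (lt_div_iff₀ hK0).1 h.2⟩
  filter_upwards [hev] with t ⟨ht, ht1, htr⟩
  have hTn : ∀ v ∈ V, ‖anisoScale L u t v‖ ≤ t * (K * ‖v‖) := fun v _ =>
    norm_anisoScale_le L u ht.le ht1 v
  have hTr : ∀ v ∈ V, ‖anisoScale L u t v‖ < r := by
    intro v hv
    refine ((hTn v hv).trans ?_).trans_lt htr
    have : ‖v‖ ≤ 1 := hv.1.le
    gcongr
    exact mul_le_of_le_one_right hK0.le this
  have hTsq : ∀ v ∈ V, ‖anisoScale L u t v‖ ^ 2 ≤ t ^ 2 * (K ^ 2 * ‖v‖ ^ 2) := by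
    intro v hv
    calc _ ≤ (t * (K * ‖v‖)) ^ 2 := by gcongr; exact hTn v hv
      _ = _ := by ring
  have hTre : ∀ v, (L (anisoScale L u t v)).re = t ^ 2 * (L v).re := by
    intro v
    rw [apply_anisoScale hu, ← Complex.ofReal_pow, Complex.re_ofReal_mul]
  have hmem : ∀ v ∈ V, s + anisoScale L u t v ∈ Ω := by
    intro v hv
    refine hΩA _ (hTr v hv) ?_
    rw [hTre]
    calc A * ‖anisoScale L u t v‖ ^ 2 ≤ A * (t ^ 2 * (K ^ 2 * ‖v‖ ^ 2)) := by
          gcongr; exact hTsq v hv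
      _ = t ^ 2 * (A * (K ^ 2 * ‖v‖ ^ 2)) := by ring
      _ < _ := by
          have := hv.2
          simp only [mem_ofPred_eq] at this
          gcongr
  have hsub : (fun v => s + anisoScale L u t v) '' V ⊆ Ω := by
    rintro _ ⟨v, hv, rfl⟩
    exact hmem v hv
  refine le_trans ?_ (lintegral_mono_set hsub)
  rw [setLIntegral_image_anisoScale μ hu ht.ne' s hVo.measurableSet, ← setLIntegral_const]
  refine setLIntegral_mono' hVo.measurableSet fun v hv => ?_
  rw [← ENNReal.ofReal_mul (by positivity)]
  refine ENNReal.ofReal_le_ofReal ?_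
  rw [norm_peak_sq ht, ← mul_pow]
  have hv1 : ‖v‖ ≤ 1 := hv.1.le
  have hlow := sq_le_norm_add_sq (hf _ (hmem v hv)) t
  have hup : ‖f (s + anisoScale L u t v) + (t : ℂ) ^ 2‖ ≤ t ^ 2 * C₂ := by
    have e1 : ‖f (s + anisoScale L u t v) - L (anisoScale L u t v)‖ ≤ C * (t ^ 2 * K ^ 2) := by
      refine (hfL _ (hTr v hv)).trans ?_
      gcongr
      refine (hTsq v hv).trans ?_
      gcongr
      exact mul_le_of_le_one_right (by positivity) (pow_le_one₀ (norm_nonneg _) hv1)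
    have e2 : ‖L (anisoScale L u t v)‖ ≤ t ^ 2 * ‖L‖ := by
      rw [apply_anisoScale hu, norm_mul, norm_pow, Complex.norm_real, Real.norm_of_nonneg ht.le]
      gcongr
      exact (L.le_opNorm v).trans (mul_le_of_le_one_right (norm_nonneg _) hv1)
    have e3 : ‖(t : ℂ) ^ 2‖ = t ^ 2 := by
      rw [norm_pow, Complex.norm_real, Real.norm_of_nonneg ht.le]
    have e4 : f (s + anisoScale L u t v) + (t : ℂ) ^ 2 =
        (f (s + anisoScale L u t v) - L (anisoScale L u t v)) + L (anisoScale L u t v)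
          + (t : ℂ) ^ 2 := by ring
    rw [e4]
    calc _ ≤ C * (t ^ 2 * K ^ 2) + t ^ 2 * ‖L‖ + t ^ 2 :=
          (norm_add₃_le).trans (by rw [e3]; gcongr)
      _ = _ := by rw [hC₂]; ring
  have hpos : 0 < ‖f (s + anisoScale L u t v) + (t : ℂ) ^ 2‖ :=
    lt_of_lt_of_le (by positivity) hlow
  gcongr
  rw [mul_div_assoc', div_le_div_iff₀ hC₂0 hpos]
  nlinarith

end PeakFunction

section WeakConvergence

/-- A bounded sequence in `L²` tending to zero almost everywhere is weakly null. -/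
theorem tendsto_integral_conj_mul_zero {α : Type*} [MeasurableSpace α] {μ : Measure α}
    {f : α → ℂ} {g : ℕ → α → ℂ} (hfm : AEStronglyMeasurable f μ)
    (hgm : ∀ j, AEStronglyMeasurable (g j) μ) (hf : Integrable (fun z => ‖f z‖ ^ 2) μ)
    (hg : ∀ j, Integrable (fun z => ‖g j z‖ ^ 2) μ) {C : ℝ}
    (hC : ∀ j, ∫ z, ‖g j z‖ ^ 2 ∂μ ≤ C)
    (hlim : ∀ᵐ z ∂μ, Tendsto (fun j => g j z) atTop (𝓝 0)) :
    Tendsto (fun j => ∫ z, (starRingEnd ℂ) (f z) * g j z ∂μ) atTop (𝓝 0) := by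
  rw [Metric.tendsto_nhds]
  intro ε hε
  set a := ε / (|C| + 1) with ha
  have ha0 : 0 < a := by positivity
  set m : ℕ → α → ℝ := fun j z => min (‖f z‖ * ‖g j z‖) (‖f z‖ ^ 2 / (2 * a)) with hm
  have hdom : Integrable (fun z => ‖f z‖ ^ 2 / (2 * a)) μ := hf.div_const _
  have hmm : ∀ j, AEStronglyMeasurable (m j) μ := fun j =>
    (hfm.norm.mul (hgm j).norm).inf hdom.aestronglyMeasurable
  have hm0 : ∀ j z, 0 ≤ m j z := fun j z => le_min (by positivity) (by positivity)
  have hmle : ∀ j z, ‖m j z‖ ≤ ‖f z‖ ^ 2 / (2 * a) := fun j z => by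
    rw [Real.norm_of_nonneg (hm0 j z)]; exact min_le_right _ _
  have hmi : ∀ j, Integrable (m j) μ := fun j =>
    hdom.mono' (hmm j) (Eventually.of_forall (hmle j))
  have hmt : Tendsto (fun j => ∫ z, m j z ∂μ) atTop (𝓝 (∫ _, (0 : ℝ) ∂μ)) := by
    refine tendsto_integral_of_dominated_convergence _ hmm hdom
      (fun j => Eventually.of_forall (hmle j)) ?_
    filter_upwards [hlim] with z hz
    have h1 : Tendsto (fun j => ‖f z‖ * ‖g j z‖) atTop (𝓝 0) := by
      simpa using hz.norm.const_mul ‖f z‖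
    exact squeeze_zero (fun j => hm0 j z) (fun j => min_le_left _ _) h1
  rw [integral_zero] at hmt
  filter_upwards [hmt.eventually (gt_mem_nhds (half_pos hε))] with j hj
  have hpt : ∀ z, ‖(starRingEnd ℂ) (f z) * g j z‖ ≤ a / 2 * ‖g j z‖ ^ 2 + m j z := by
    intro z
    rw [norm_mul, RCLike.norm_conj]
    have h1 : ‖f z‖ * ‖g j z‖ ≤ a / 2 * ‖g j z‖ ^ 2 + ‖f z‖ ^ 2 / (2 * a) := by
      have : a / 2 * ‖g j z‖ ^ 2 + ‖f z‖ ^ 2 / (2 * a) - ‖f z‖ * ‖g j z‖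
          = (a * ‖g j z‖ - ‖f z‖) ^ 2 / (2 * a) := by field_simp; ring
      have h2 : 0 ≤ (a * ‖g j z‖ - ‖f z‖) ^ 2 / (2 * a) := by positivity
      linarith
    have h3 : 0 ≤ a / 2 * ‖g j z‖ ^ 2 := by positivity
    rcases min_choice (‖f z‖ * ‖g j z‖) (‖f z‖ ^ 2 / (2 * a)) with h | h <;>
      simp only [hm, h] <;> linarith
  rw [dist_zero_right]
  calc ‖∫ z, (starRingEnd ℂ) (f z) * g j z ∂μ‖
      ≤ ∫ z, (a / 2 * ‖g j z‖ ^ 2 + m j z) ∂μ :=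
        norm_integral_le_of_norm_le (((hg j).const_mul _).add (hmi j))
          (Eventually.of_forall hpt)
    _ = a / 2 * ∫ z, ‖g j z‖ ^ 2 ∂μ + ∫ z, m j z ∂μ := by
        rw [integral_add ((hg j).const_mul _) (hmi j), integral_const_mul]
    _ ≤ a / 2 * (|C| + 1) + ∫ z, m j z ∂μ := by
        gcongr
        exact (hC j).trans (by linarith [le_abs_self C])
    _ = ε / 2 + ∫ z, m j z ∂μ := by rw [ha]; field_simp
    _ < ε := by linarith

end WeakConvergence

section ContactGeometry

variable {E : Type*} [NormedAddCommGroup E] [NormedSpace ℂ E] [NormedSpace ℝ E]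

/-- A `C²` sublevel set contains a paraboloid touching its boundary from inside. -/
theorem exists_paraboloid_subset {ρ : E → ℝ} (hρ : ContDiff ℝ 2 ρ) {s : E} (hρs : ρ s = 0)
    {L : E →L[ℂ] ℂ} {k : ℝ} (hk : 0 < k) (hL : ∀ w, (L w).re = -(k * fderiv ℝ ρ s w)) :
    ∃ A > 0, ∃ r > 0, ∀ w, ‖w‖ < r → A * ‖w‖ ^ 2 < (L w).re → ρ (s + w) < 0 := by
  obtain ⟨r, hr, hT⟩ := exists_taylor_two_bound hρ s one_pos
  set H := fderiv ℝ (fderiv ℝ ρ) s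
  refine ⟨k * (‖H‖ + 1), by positivity, r, hr, fun w hw hA => ?_⟩
  have h1 := (abs_le.1 (hT w hw)).2
  have h2 : H w w ≤ ‖H‖ * ‖w‖ ^ 2 := by
    have := (le_abs_self _).trans (H.le_opNorm₂ w w)
    linarith
  rw [hL, mul_assoc, ← mul_neg, mul_lt_mul_iff_right₀ hk] at hA
  have h3 : 0 ≤ ‖H‖ * ‖w‖ ^ 2 := by positivity
  linarith

variable [IsScalarTower ℝ ℂ E]

/-- A complex functional whose real part is non-negative on a real open half-space has real part
proportional to the functional defining the half-space. -/
theorem exists_pos_re_eq_neg_mul {L : E →L[ℂ] ℂ} (hL : L ≠ 0) {ℓ : E →L[ℝ] ℝ} (hℓ : ℓ ≠ 0)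
    (h : ∀ w, ℓ w < 0 → 0 ≤ (L w).re) : ∃ k > 0, ∀ w, (L w).re = -(k * ℓ w) := by
  set R : E →L[ℝ] ℝ := Complex.reCLM.comp (L.restrictScalars ℝ) with hR
  have hRL : ∀ w, (L w).re = R w := fun w => rfl
  obtain ⟨w₀, hw₀⟩ : ∃ w₀, ℓ w₀ = -1 := by
    obtain ⟨v, hv⟩ : ∃ v, ℓ v ≠ 0 := by
      by_contra! h
      exact hℓ (ContinuousLinearMap.ext h)
    exact ⟨(-(ℓ v)⁻¹) • v, by simp [hv]⟩
  have hker : ∀ w, ℓ w = 0 → R w = 0 := by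
    intro w hw
    by_contra hne
    have h1 := h (w₀ + (-(R w₀ + 1) / R w) • w) (by simp [hw, hw₀])
    rw [hRL, map_add, map_smul, smul_eq_mul, div_mul_cancel₀ _ hne] at h1
    linarith
  have hall : ∀ w, R w = -(R w₀ * ℓ w) := by
    intro w
    have h1 := hker (w + ℓ w • w₀) (by simp [hw₀])
    rw [map_add, map_smul, smul_eq_mul] at h1
    linarith
  refine ⟨R w₀, lt_of_le_of_ne (h w₀ (by rw [hw₀]; norm_num)) fun h0 => hL ?_, hall⟩
  have hzero : ∀ w, (L w).re = 0 := fun w => by rw [hRL, hall, ← h0]; simp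
  ext w
  refine Complex.ext (hzero w) ?_
  have := hzero (Complex.I • w)
  simpa using this

/-- First order boundary behaviour of a holomorphic function with non-negative real part. -/
theorem re_fderiv_nonneg_of_neg {ρ : E → ℝ} {s : E} (hρ : DifferentiableAt ℝ ρ s) (hρs : ρ s = 0)
    {f : E → ℂ} {L : E →L[ℂ] ℂ} (hf : HasFDerivAt f L s) (hfs : f s = 0)
    (hfre : ∀ z, ρ z < 0 → 0 ≤ (f z).re) {w : E} (hw : fderiv ℝ ρ s w < 0) :
    0 ≤ (L w).re := by
  have hline : HasDerivAt (fun τ : ℝ => s + τ • w) w 0 := by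
    simpa using ((hasDerivAt_id (0 : ℝ)).smul_const w).const_add s
  have h1 : HasDerivAt (fun τ : ℝ => ρ (s + τ • w)) (fderiv ℝ ρ s w) 0 := by
    refine HasFDerivAt.comp_hasDerivAt (f := fun τ : ℝ => s + τ • w) 0 ?_ hline
    simpa using hρ.hasFDerivAt
  have h2 : HasDerivAt (fun τ : ℝ => (f (s + τ • w)).re) (L w).re 0 := by
    have hre : HasFDerivAt (fun z => (f z).re) (Complex.reCLM.comp (L.restrictScalars ℝ)) s :=
      Complex.reCLM.hasFDerivAt.comp s (hf.restrictScalars ℝ)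
    have hre' : HasFDerivAt (fun z => (f z).re)
        (Complex.reCLM.comp (L.restrictScalars ℝ)) (s + (0 : ℝ) • w) := by simpa using hre
    exact hre'.comp_hasDerivAt (f := fun τ : ℝ => s + τ • w) 0 hline
  have t1 := (hasDerivAt_iff_tendsto_slope.1 h1).mono_left
    (nhdsWithin_mono 0 fun x (hx : x ∈ Ioi (0 : ℝ)) => (ne_of_gt hx : x ≠ 0))
  have t2 := (hasDerivAt_iff_tendsto_slope.1 h2).mono_left
    (nhdsWithin_mono 0 fun x (hx : x ∈ Ioi (0 : ℝ)) => (ne_of_gt hx : x ≠ 0))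
  refine ge_of_tendsto t2 ?_
  filter_upwards [t1.eventually (gt_mem_nhds hw), self_mem_nhdsWithin] with τ hτ hτ0
  have hτ0 : 0 < τ := hτ0
  simp only [slope_def_field, zero_smul, add_zero, hρs, hfs, sub_zero, Complex.zero_re] at hτ ⊢
  have hneg : ρ (s + τ • w) < 0 := by
    by_contra hc
    exact absurd hτ (not_lt.2 (div_nonneg (not_lt.1 hc) hτ0.le))
  exact div_nonneg (hfre _ hneg) hτ0.le

end ContactGeometry

section PeakSequence

variable {E : Type*} [NormedAddCommGroup E] [NormedSpace ℂ E]

theorem add_sq_ne_zero_of_re_nonneg {x : ℂ} (hx : 0 ≤ x.re) {t : ℝ} (ht : 0 < t) :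
    x + (t : ℂ) ^ 2 ≠ 0 := by
  rw [← norm_pos_iff]
  exact lt_of_lt_of_le (by positivity) (sq_le_norm_add_sq hx t)

theorem differentiableOn_peak {Ω : Set E} {f : E → ℂ} (hf : DifferentiableOn ℂ f Ω)
    (hre : ∀ z ∈ Ω, 0 ≤ (f z).re) {t : ℝ} (ht : 0 < t) (N : ℕ) :
    DifferentiableOn ℂ (fun z => ((t : ℂ) / (f z + (t : ℂ) ^ 2)) ^ N) Ω := by
  simp only [div_eq_mul_inv]
  exact (((hf.add_const _).fun_inv fun z hz =>
    add_sq_ne_zero_of_re_nonneg (hre z hz) ht).const_mul (t : ℂ)).fun_pow N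

theorem integrableOn_norm_peak_sq [MeasurableSpace E] [BorelSpace E] {μ : Measure E} {Ω : Set E}
    (hΩ : IsOpen Ω) (hμ : μ Ω < ⊤) {f : E → ℂ} (hf : DifferentiableOn ℂ f Ω)
    (hre : ∀ z ∈ Ω, 0 ≤ (f z).re) {t : ℝ} (ht : 0 < t) (N : ℕ) :
    IntegrableOn (fun z => ‖((t : ℂ) / (f z + (t : ℂ) ^ 2)) ^ N‖ ^ 2) Ω μ := by
  have : IsFiniteMeasure (μ.restrict Ω) := ⟨by simpa using hμ⟩
  refine Integrable.of_bound ?_ ((t / t ^ 2) ^ (2 * N)) ?_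
  · have hc : ContinuousOn (fun z => ‖((t : ℂ) / (f z + (t : ℂ) ^ 2)) ^ N‖ ^ 2) Ω :=
      (differentiableOn_peak hf hre ht N).continuousOn.norm.pow 2
    exact hc.aestronglyMeasurable hΩ.measurableSet
  · filter_upwards [ae_restrict_mem hΩ.measurableSet] with z hz
    rw [Real.norm_of_nonneg (by positivity), norm_peak_sq ht]
    have := sq_le_norm_add_sq (hre z hz) t
    gcongr

theorem tendsto_peak_zero {x : ℂ} (hx : x ≠ 0) {N : ℕ} (hN : N ≠ 0) {τ : ℕ → ℝ}
    (hτ : Tendsto τ atTop (𝓝 0)) :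
    Tendsto (fun j => ((τ j : ℂ) / (x + (τ j : ℂ) ^ 2)) ^ N) atTop (𝓝 0) := by
  have h1 : Tendsto (fun j => (τ j : ℂ)) atTop (𝓝 0) := by
    exact_mod_cast (Complex.continuous_ofReal.tendsto 0).comp hτ
  have h2 := (h1.div ((h1.pow 2).const_add x) (by simpa using hx)).pow N
  simpa [hN] using h2

end PeakSequence

/-- Compactness of the composition operator forces the Jacobian determinant to vanish at boundary
points that are mapped to boundary points. -/
theorem Jdet_eq_zero_of_compactCompOp {n : ℕ} {Ω : Set (Cn n)} (hΩo : IsOpen Ω)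
    (hΩc : Convex ℝ Ω) (hΩb : Bornology.IsBounded Ω) {ρ : Cn n → ℝ} (hρ : IsDefiningFn Ω ⊤ ρ)
    (hstrong : ∀ p ∈ frontier Ω, ∀ v : Cn n, v ≠ 0 → fderiv ℝ ρ p v = 0 →
      0 < fderiv ℝ (fun q => fderiv ℝ ρ q v) p v)
    {φ : Cn n → Cn n} {U : Set (Cn n)} (hU : IsOpen U) (hUc : closure Ω ⊆ U)
    (hφU : DifferentiableOn ℂ φ U) (hφm : Set.MapsTo φ Ω Ω) (hcomp : CompactCompOp Ω φ)
    {s : Cn n} (hs : s ∈ frontier Ω) (hφs : φ s ∈ frontier Ω) : Jdet φ s = 0 := by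
  by_contra hdet
  obtain ⟨hρs, hΩρ, hfr, hdρ⟩ := hρ
  have hρ2 : ContDiff ℝ 2 ρ := contDiff_infty.1 hρs 2
  have hmemΩ : ∀ z, z ∈ Ω ↔ ρ z < 0 := fun z => by rw [hΩρ]; rfl
  have hmemfr : ∀ z, z ∈ frontier Ω ↔ ρ z = 0 := fun z => by rw [hfr]; rfl
  set p := φ s with hp
  have hdiff : Differentiable ℝ (fderiv ℝ ρ) :=
    (hρ2.fderiv_right (m := 1) (by norm_num)).differentiable (by norm_num)
  have hpos : ∀ v, v ≠ 0 → fderiv ℝ ρ p v = 0 → 0 < fderiv ℝ (fderiv ℝ ρ) p v v := by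
    intro v hv hv0
    have h1 := hstrong p hφs v hv hv0
    have h2 : HasFDerivAt (fun q => fderiv ℝ ρ q v)
        ((ContinuousLinearMap.apply ℝ ℝ v).comp (fderiv ℝ (fderiv ℝ ρ) p)) p :=
      (ContinuousLinearMap.apply ℝ ℝ v).hasFDerivAt.comp p (hdiff p).hasFDerivAt
    rwa [h2.fderiv] at h1
  obtain ⟨c, hc, hcΩ⟩ := exists_paraboloid_support hΩo hΩc hΩb hρ2
    (fun z hz => (hmemΩ z).1 hz) (frontier_subset_closure hφs) ((hmemfr p).1 hφs) hpos
  set h₀ : Cn n →L[ℂ] ℂ := StrongDual.extendRCLike (𝕜 := ℂ) (-fderiv ℝ ρ p) with hh₀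
  have hre₀ : ∀ w, (h₀ w).re = -fderiv ℝ ρ p w := fun w => by
    exact StrongDual.re_extendRCLike_apply (𝕜 := ℂ) (-fderiv ℝ ρ p) w
  have hh₀ne : h₀ ≠ 0 := by
    intro h
    refine hdρ p hφs (ContinuousLinearMap.ext fun w => ?_)
    have := hre₀ w
    rw [h] at this
    simpa using this.symm
  have hsU : s ∈ U := hUc (frontier_subset_closure hs)
  have hφd : HasFDerivAt φ (fderiv ℂ φ s) s :=
    (hφU.differentiableAt (hU.mem_nhds hsU)).hasFDerivAt
  set L : Cn n →L[ℂ] ℂ := h₀.comp (fderiv ℂ φ s) with hLdef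
  have hLne : L ≠ 0 := by
    intro h
    refine hh₀ne (ContinuousLinearMap.ext fun w => ?_)
    have hunit : IsUnit (fderiv ℂ φ s).toLinearMap := by
      rw [LinearMap.isUnit_iff_isUnit_det]
      exact isUnit_iff_ne_zero.2 hdet
    obtain ⟨v, hv⟩ := ((Module.End.isUnit_iff _).1 hunit).2 w
    have := congrArg (fun T : Cn n →L[ℂ] ℂ => T v) h
    rw [← hv]
    exact this
  set f : Cn n → ℂ := fun z => h₀ (φ z - p) with hf
  have hfs : f s = 0 := by simp [hf, hp]
  have hfd : HasFDerivAt f L s := h₀.hasFDerivAt.comp s (hφd.sub_const p)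
  have hfU : DifferentiableOn ℂ f U := h₀.differentiable.comp_differentiableOn (hφU.sub_const p)
  have hgre : ∀ z ∈ Ω, 0 ≤ (h₀ (z - p)).re := fun z hz => by
    rw [hre₀]
    exact le_trans (by positivity) (hcΩ z hz)
  have hfre : ∀ z ∈ Ω, 0 ≤ (f z).re := fun z hz => hgre _ (hφm hz)
  obtain ⟨k, hk, hLk⟩ := exists_pos_re_eq_neg_mul hLne (hdρ s hs) fun w hw =>
    re_fderiv_nonneg_of_neg (hρ2.differentiable (by norm_num) s) ((hmemfr s).1 hs) hfd hfs
      (fun z hz => hfre z ((hmemΩ z).2 hz)) hw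
  obtain ⟨A, hA, r₁, hr₁, hAr⟩ := exists_paraboloid_subset hρ2 ((hmemfr s).1 hs) hk hLk
  obtain ⟨C, hC, r₂, hr₂, hCr⟩ := exists_holomorphic_taylor_one_bound hU hfU hsU
  set N := Module.finrank ℂ (Cn n) + 1 with hN
  obtain ⟨a, ha, hev⟩ := exists_lintegral_peak_comp_ge (volume : Measure (Cn n)) hfre hLne (s := s)
    hC (lt_min hr₁ hr₂) hA
    (fun w hw => by
      have := hCr w (hw.trans_le (min_le_right _ _))
      rwa [hfs, sub_zero, hfd.fderiv] at this)
    (fun w hw hw' => (hmemΩ _).2 (hAr w (hw.trans_le (min_le_left _ _)) hw'))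
  obtain ⟨B, hB, hBle⟩ := exists_lintegral_peak_le (volume : Measure (Cn n)) hΩo.measurableSet
    hh₀ne p hc (fun z hz => by rw [hre₀]; exact hcΩ z hz)
  have hvol : volume Ω < ⊤ := hΩb.measure_lt_top
  set τ : ℕ → ℝ := fun j => 1 / ((j : ℝ) + 1) with hτ
  have hτ0 : ∀ j, 0 < τ j := fun j => Nat.one_div_pos_of_nat
  have hτ1 : ∀ j, τ j ≤ 1 := fun j => by
    rw [hτ]
    exact div_le_one_of_le₀ (by linarith [j.cast_nonneg (α := ℝ)]) (by positivity)
  have hτlim : Tendsto τ atTop (𝓝 0) := tendsto_one_div_add_atTop_nhds_zero_nat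
  have hlin : DifferentiableOn ℂ (fun z => h₀ (z - p)) Ω :=
    (h₀.differentiable.comp (differentiable_id.sub_const p)).differentiableOn
  set g : ℕ → Cn n → ℂ := fun j z => ((τ j : ℂ) / (h₀ (z - p) + (τ j : ℂ) ^ 2)) ^ N with hg
  have hgd : ∀ j, DifferentiableOn ℂ (g j) Ω := fun j => differentiableOn_peak hlin hgre (hτ0 j) N
  have hgi : ∀ j, IntegrableOn (fun z => ‖g j z‖ ^ 2) Ω volume := fun j =>
    integrableOn_norm_peak_sq hΩo hvol hlin hgre (hτ0 j) N
  have hgB : ∀ j, ∫ z in Ω, ‖g j z‖ ^ 2 ≤ B := by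
    intro j
    rw [← ENNReal.ofReal_le_ofReal_iff hB, ofReal_integral_eq_lintegral_ofReal (hgi j)
      (Eventually.of_forall fun z => by positivity)]
    exact hBle (τ j) (hτ0 j) (hτ1 j)
  have hpΩ : p ∉ Ω := fun h => by
    have h1 := (hmemΩ p).1 h
    rw [(hmemfr p).1 hφs] at h1
    exact lt_irrefl _ h1
  have hweak : WeakNull Ω g := by
    refine ⟨fun j => ⟨hgd j, hgi j⟩, fun F hF => ?_⟩
    have hmeas : ∀ {G : Cn n → ℂ}, DifferentiableOn ℂ G Ω →
        AEStronglyMeasurable G (volume.restrict Ω) := fun hG =>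
      hG.continuousOn.aestronglyMeasurable hΩo.measurableSet
    exact tendsto_integral_conj_mul_zero (hmeas hF.1) (fun j => hmeas (hgd j)) hF.2 hgi hgB (by
      filter_upwards [ae_restrict_mem hΩo.measurableSet] with z hz
      refine tendsto_peak_zero (fun h0 => hpΩ ?_) (Nat.succ_ne_zero _) hτlim
      have h1 := hcΩ z hz
      rw [← hre₀, h0, Complex.zero_re] at h1
      have h2 : ‖z - p‖ ^ 2 = 0 := le_antisymm (by nlinarith) (by positivity)
      rw [sq_eq_zero_iff, norm_eq_zero, sub_eq_zero] at h2
      rwa [← h2])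
  have hlim := hcomp g hweak
  have hlow : ∀ᶠ j in atTop, a ≤ ENNReal.ofReal (a2NormSq Ω fun z => g j (φ z)) := by
    have hτw : Tendsto τ atTop (𝓝[>] 0) :=
      tendsto_nhdsWithin_iff.2 ⟨hτlim, Eventually.of_forall hτ0⟩
    filter_upwards [hτw.eventually hev] with j hj
    refine hj.trans_eq ?_
    exact (ofReal_integral_eq_lintegral_ofReal
      (integrableOn_norm_peak_sq hΩo hvol
        (hfU.mono (subset_closure.trans hUc)) hfre (hτ0 j) N)
      (Eventually.of_forall fun z => by positivity)).symm
  have hlim' := (ENNReal.continuous_ofReal.tendsto 0).comp hlim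
  rw [ENNReal.ofReal_zero] at hlim'
  exact absurd (ge_of_tendsto hlim' hlow) (not_le.2 ha)

/-- for a smoothly bounded strongly convex domain and `φ` holomorphic
near the closure, compactness of `C_φ` forces `∂Ω ∩ ∂(φ(closure Ω))` to be nowhere
dense in `∂Ω`. -/
theorem stmt11 {n : ℕ} (Ω : Set (Cn n)) (hΩo : IsOpen Ω) (hΩc : Convex ℝ Ω)
    (hΩb : Bornology.IsBounded Ω) (hΩne : Ω.Nonempty)
    (ρ : Cn n → ℝ) (hρ : IsDefiningFn Ω ⊤ ρ)
    (hstrong : ∀ p ∈ frontier Ω, ∀ v : Cn n, v ≠ 0 → fderiv ℝ ρ p v = 0 →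
      0 < fderiv ℝ (fun q => fderiv ℝ ρ q v) p v)
    (φ : Cn n → Cn n) (U : Set (Cn n)) (hU : IsOpen U) (hUc : closure Ω ⊆ U)
    (hφU : DifferentiableOn ℂ φ U) (hφm : Set.MapsTo φ Ω Ω)
    (hcomp : CompactCompOp Ω φ) :
    IsNowhereDense {x : (frontier Ω : Set (Cn n)) |
      (x : Cn n) ∈ frontier (φ '' closure Ω)} := by
  have hdet : ∀ s ∈ frontier Ω, φ s ∈ frontier Ω → Jdet φ s = 0 := fun s =>
    Jdet_eq_zero_of_compactCompOp hΩo hΩc hΩb hρ hstrong hU hUc hφU hφm hcomp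
  obtain ⟨hρs, hΩρ, hfr, hdρ⟩ := hρ
  have hρ1 : ContDiff ℝ 1 ρ := hρs.of_le (by exact_mod_cast (le_top : (1 : ℕ∞) ≤ ⊤))
  have hmemfr : ∀ z, z ∈ frontier Ω ↔ ρ z = 0 := fun z => by rw [hfr]; rfl
  have himg : IsClosed (φ '' closure Ω) :=
    (hΩb.isCompact_closure.image_of_continuousOn (hφU.continuousOn.mono hUc)).isClosed
  have hcl : IsClosed {x : (frontier Ω : Set (Cn n)) | (x : Cn n) ∈ frontier (φ '' closure Ω)} :=
    isClosed_frontier.preimage continuous_subtype_val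
  rw [IsNowhereDense, hcl.closure_eq, ← Set.not_nonempty_iff_eq_empty]
  rintro ⟨⟨p, hp⟩, hpint⟩
  obtain ⟨δ, hδ, hball⟩ := Metric.mem_nhds_iff.1 (mem_interior_iff_mem_nhds.1 hpint)
  set S : Set (Cn n) := {s | s ∈ frontier Ω ∧ φ s ∈ frontier Ω} with hS
  have hV : ∀ x, ρ x = 0 → dist x p < δ → x ∈ φ '' S := by
    intro x hx hxp
    have hxf := (hmemfr x).2 hx
    have hxb : (⟨x, hxf⟩ : (frontier Ω : Set (Cn n))) ∈ ball ⟨p, hp⟩ δ := by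
      rwa [mem_ball, Subtype.dist_eq]
    have hx' : x ∈ frontier (φ '' closure Ω) := by
      simpa only [mem_ofPred_eq] using hball hxb
    obtain ⟨s, hs, rfl⟩ := himg.frontier_subset hx'
    refine ⟨s, ⟨⟨hs, fun hsi => ?_⟩, hxf⟩, rfl⟩
    rw [hΩo.interior_eq] at hsi
    rw [hΩo.frontier_eq] at hxf
    exact hxf.2 (hφm hsi)
  obtain ⟨ν, hν⟩ : ∃ ν, 0 < fderiv ℝ ρ p ν := by
    obtain ⟨v, hv⟩ : ∃ v, fderiv ℝ ρ p v ≠ 0 := by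
      by_contra! h
      exact hdρ p hp (ContinuousLinearMap.ext h)
    exact ⟨(fderiv ℝ ρ p v)⁻¹ • v, by simp [hv]⟩
  have hnull := measure_image_add_line_eq_zero (volume : Measure (Cn n)) hρ1 (S := S) (φ := φ)
    (fun s hs => (hmemfr s).1 hs.1) (fun s hs => hdρ s hs.1)
    (fun s hs => hφU.differentiableAt (hU.mem_nhds (hUc (frontier_subset_closure hs.1))))
    (fun s hs => hdet s hs.1 hs.2) ν
  have hpos := measure_add_line_pos (volume : Measure (Cn n)) hρ1.continuous ((hmemfr p).1 hp)
    (hρ1.differentiable (by norm_num) p).hasFDerivAt hν hδ hV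
  refine hpos.ne' (measure_mono_null ?_ hnull)
  rintro y ⟨_, ⟨s, hs, rfl⟩, t, rfl⟩
  exact ⟨s, hs, t, rfl⟩
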